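/- Let D = (V,E) be an r-rooted digraph (possibly infinite), v ∈ V \ {r}, and L ⊆ E. If the local edge-connectivity λ_D(r,v) (the maximal number of pairwise edge-disjoint rv-paths in D) is finite, then L is large at v if and only if λ_{D(L)}(r,v) = λ_D(r,v). -/

import Mathlib

/-- A digraph on vertex type `V` with edge type `E` (parallel edges allowed, no loops). -/
structure MultiDigraph (V : Type*) (E : Type*) where
  tail : E → V
  head : E → V
  no_loops : ∀ e, tail e ≠ head e

namespace MultiDigraph

variable {V E : Type*}

/-- `p` is a (finite) directed path from `s` to `t` in the spanning subdigraph `D(L)`,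
identified with its list of edges (consecutive edges are incident, visited vertices
are pairwise distinct). -/
def IsPathIn (D : MultiDigraph V E) (L : Set E) (s t : V) (p : List E) : Prop :=
  ∃ hne : p ≠ [],
    D.tail (p.head hne) = s ∧
    D.head (p.getLast hne) = t ∧
    p.Chain' (fun e f => D.head e = D.tail f) ∧
    (s :: p.map D.head).Nodup ∧
    ∀ e ∈ p, e ∈ L

/-- `δ_{D(L)}(v)`: the set of ingoing edges of `v` lying in `L`. -/
def delta (D : MultiDigraph V E) (L : Set E) (v : V) : Set E :=
  {e | e ∈ L ∧ D.head e = v}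

/-- `δ_{D(L)}(X)`: the set of edges of `D(L)` entering the vertex set `X`
(tail outside `X`, head inside `X`). -/
def edgesInto (D : MultiDigraph V E) (L : Set E) (X : Set V) : Set E :=
  {e | e ∈ L ∧ D.tail e ∉ X ∧ D.head e ∈ X}

/-- `I ∈ 𝒢_{D(L)}(v)`: `I` is a set of ingoing edges of `v` in `D(L)` for which
there is a set of pairwise edge-disjoint `r`–`v` paths of `D(L)` covering `I`. -/
def MemGv (D : MultiDigraph V E) (L : Set E) (r v : V) (I : Set E) : Prop :=
  I ⊆ D.delta L v ∧
  ∃ Ps : Set (List E),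
    (∀ p ∈ Ps, D.IsPathIn L r v p) ∧
    Ps.Pairwise (fun p q => p.Disjoint q) ∧
    ∀ e ∈ I, ∃ p ∈ Ps, e ∈ p

/-- `L' ∈ 𝒢(D(L))`: `L'` is a union `⋃_{v ≠ r} I_v` with `I_v ∈ 𝒢_{D(L)}(v)`;
equivalently, every edge of `L'` has head distinct from `r` and for each `v ≠ r`
the set of ingoing edges of `v` in `L'` belongs to `𝒢_{D(L)}(v)`. -/
def MemG (D : MultiDigraph V E) (L : Set E) (r : V) (L' : Set E) : Prop :=
  L' ⊆ L ∧ (∀ e ∈ L', D.head e ≠ r) ∧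
    ∀ v, v ≠ r → D.MemGv L r v (D.delta L' v)

/-- `F` is a flame: `F ∈ 𝒢(D(F))`. -/
def IsFlame (D : MultiDigraph V E) (r : V) (F : Set E) : Prop :=
  D.MemG F r F

/-- `C` is a transversal of the set `Ps` of paths: `C` consists of exactly one
edge from each path in `Ps`. -/
def IsTransversal (Ps : Set (List E)) (C : Set E) : Prop :=
  (∀ p ∈ Ps, ∃! e, e ∈ C ∧ e ∈ p) ∧ ∀ e ∈ C, ∃ p ∈ Ps, e ∈ p

/-- `C` is an `s`–`t` cut in `D(L)`: every `s`–`t` path of `D(L)` meets `C`. -/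
def IsCut (D : MultiDigraph V E) (L : Set E) (s t : V) (C : Set E) : Prop :=
  ∀ p, D.IsPathIn L s t p → ∃ e ∈ p, e ∈ C

/-- `L` is large at `v`: `D(L)` admits a set `Ps` of pairwise edge-disjoint
`r`–`v` paths together with a transversal of `Ps` that is an `r`–`v` cut in `D`. -/
def LargeAt (D : MultiDigraph V E) (r v : V) (L : Set E) : Prop :=
  ∃ (Ps : Set (List E)) (C : Set E),
    (∀ p ∈ Ps, D.IsPathIn L r v p) ∧
    Ps.Pairwise (fun p q => p.Disjoint q) ∧
    IsTransversal Ps C ∧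
    D.IsCut Set.univ r v C

/-- `L` is large: it is large at every `v ≠ r`. -/
def Large (D : MultiDigraph V E) (r : V) (L : Set E) : Prop :=
  ∀ v, v ≠ r → D.LargeAt r v L

/-- `D` contains a directed cycle. -/
def HasCycle (D : MultiDigraph V E) : Prop :=
  ∃ (p : List E) (hne : p ≠ []),
    p.Chain' (fun e f => D.head e = D.tail f) ∧
    D.head (p.getLast hne) = D.tail (p.head hne) ∧
    (p.map D.head).Nodup

/-- `D` contains a backward-infinite path: edges `…, f 2, f 1, f 0` (with `f 0` the
last edge, so the path has a final vertex `D.head (f 0)` but no first vertex); the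
visited vertices `D.head (f n)` are pairwise distinct. -/
def HasBackwardInfinitePath (D : MultiDigraph V E) : Prop :=
  ∃ f : ℕ → E,
    (∀ n, D.tail (f n) = D.head (f (n + 1))) ∧
    Function.Injective (fun n => D.head (f n))

/-- `X ⊆ V \ {r}` is `v`-linked in `D(L)`: `v ∈ X` and there is a family
`{P e : e ∈ δ_{D(L)}(X)}` of pairwise edge-disjoint paths of `D(L)`, where `P e`
has `e` as its initial edge and `v` as its terminal vertex. -/
def VLinked (D : MultiDigraph V E) (L : Set E) (r v : V) (X : Set V) : Prop :=
  r ∉ X ∧ v ∈ X ∧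
  ∃ P : E → List E,
    (∀ e ∈ D.edgesInto L X, D.IsPathIn L (D.tail e) v (P e) ∧ (P e).head? = some e) ∧
    (D.edgesInto L X).Pairwise (fun e f => (P e).Disjoint (P f))

/-- `p` is an `r`–`X` path in `D(L)`: a path starting at `r` meeting `X` exactly
in its last vertex. -/
def IsRXPathIn (D : MultiDigraph V E) (L : Set E) (r : V) (X : Set V) (p : List E) : Prop :=
  ∃ hne : p ≠ [],
    D.tail (p.head hne) = r ∧
    D.head (p.getLast hne) ∈ X ∧
    (∀ e ∈ p.dropLast, D.head e ∉ X) ∧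
    p.Chain' (fun e f => D.head e = D.tail f) ∧
    (r :: p.map D.head).Nodup ∧
    ∀ e ∈ p, e ∈ L

/-- `X` is fillable in `D(L)`: there is a set `Ps` of pairwise edge-disjoint
`r`–`X` paths in `D(L)` whose set of terminal edges is exactly `δ_{D(L)}(X)`. -/
def Fillable (D : MultiDigraph V E) (L : Set E) (r : V) (X : Set V) : Prop :=
  ∃ Ps : Set (List E),
    (∀ p ∈ Ps, D.IsRXPathIn L r X p) ∧
    Ps.Pairwise (fun p q => p.Disjoint q) ∧
    {e | ∃ p ∈ Ps, p.getLast? = some e} = D.edgesInto L X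

end MultiDigraph

/-- There exist `n` pairwise edge-disjoint `r`–`v` paths in `D(L)`. -/
def MultiDigraph.HasEdgeDisjointPaths {V E : Type*} (D : MultiDigraph V E) (L : Set E)
    (r v : V) (n : ℕ) : Prop :=
  ∃ P : Fin n → List E,
    (∀ i, D.IsPathIn L r v (P i)) ∧
    ∀ i j, i ≠ j → (P i).Disjoint (P j)

namespace MultiDigraph

variable {V E : Type*}

theorem IsPathIn.mono {D : MultiDigraph V E} {L L' : Set E} (h : L ⊆ L') {s t : V} {p : List E}
    (hp : D.IsPathIn L s t p) : D.IsPathIn L' s t p := by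
  obtain ⟨hne, h1, h2, h3, h4, h5⟩ := hp
  exact ⟨hne, h1, h2, h3, h4, fun e he => h (h5 e he)⟩

theorem IsPathIn.nodup {D : MultiDigraph V E} {L : Set E} {s t : V} {p : List E}
    (hp : D.IsPathIn L s t p) : p.Nodup := by
  obtain ⟨-, -, -, -, h4, -⟩ := hp
  exact (List.nodup_cons.1 h4).2.of_map _

theorem sum_map_sub_of_chain (D : MultiDigraph V E) (g : V → ℤ) (l : List E) (e : E)
    (h : (e :: l).IsChain (fun e f => D.head e = D.tail f)) :
    ((e :: l).map fun e => g (D.tail e) - g (D.head e)).sum =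
      g (D.tail e) - g (D.head ((e :: l).getLast (List.cons_ne_nil e l))) := by
  induction l generalizing e with
  | nil => simp
  | cons f l ih =>
    rw [List.isChain_cons_cons] at h
    rw [List.map_cons, List.sum_cons, ih f h.2, h.1, List.getLast_cons (List.cons_ne_nil f l)]
    ring

/-- The finite edge set `F` carries a unit flow of value `k` from `s` to `t`, expressed by pairing
its boundary with arbitrary integer-valued functions on the vertices. -/
def IsFlow (D : MultiDigraph V E) (F : Finset E) (s t : V) (k : ℤ) : Prop :=
  ∀ g : V → ℤ, ∑ e ∈ F, (g (D.tail e) - g (D.head e)) = k * (g s - g t)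

theorem IsPathIn.isFlow [DecidableEq E] {D : MultiDigraph V E} {L : Set E} {s t : V} {p : List E}
    (hp : D.IsPathIn L s t p) : D.IsFlow p.toFinset s t 1 := by
  intro g
  rw [List.sum_toFinset _ hp.nodup]
  obtain ⟨hne, rfl, rfl, h3, -, -⟩ := hp
  obtain ⟨e, l, rfl⟩ := List.exists_cons_of_ne_nil hne
  rw [sum_map_sub_of_chain D g l e h3, List.head_cons, one_mul]

/-- The set of vertices reachable from `s` in `D(L)`. -/
def reach (D : MultiDigraph V E) (L : Set E) (s : V) : Set V :=
  {x | x = s ∨ ∃ p, D.IsPathIn L s x p}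

theorem head_mem_reach {D : MultiDigraph V E} {L : Set E} {s : V} {e : E} (he : e ∈ L)
    (h : D.tail e ∈ D.reach L s) : D.head e ∈ D.reach L s := by
  by_cases hs : D.head e = s
  · exact Or.inl hs
  refine Or.inr ?_
  rcases h with h | ⟨p, hne, h1, h2, h3, h4, h5⟩
  · exact ⟨[e], by simp, by simpa using h, by simp, List.isChain_singleton e,
      by simpa using Ne.symm hs, by simpa using he⟩
  by_cases hp : D.head e ∈ p.map D.head
  · obtain ⟨f, hf, hfe⟩ := List.mem_map.1 hp
    obtain ⟨l₁, l₂, rfl⟩ := List.append_of_mem hf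
    have hpre : (l₁ ++ [f]) <+: (l₁ ++ f :: l₂) := ⟨l₂, by simp⟩
    refine ⟨l₁ ++ [f], by simp, ?_, by simpa using hfe, List.IsChain.prefix h3 hpre, ?_, ?_⟩
    · rw [← h1]
      cases l₁ <;> simp
    · exact h4.sublist ((hpre.sublist.map D.head).cons_cons s)
    · exact fun x hx => h5 x (hpre.subset hx)
  · refine ⟨p ++ [e], by simp, ?_, by simp, ?_, ?_, ?_⟩
    · rw [List.head_append_of_ne_nil hne, h1]
    · refine List.IsChain.append h3 (List.isChain_singleton e) ?_
      intro x hx y hy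
      rw [List.getLast?_eq_getLast_of_ne_nil hne] at hx
      simp only [Option.mem_def, Option.some.injEq, List.head?_cons] at hx hy
      rw [← hx, ← hy, h2]
    · have : (s :: (p ++ [e]).map D.head) = (s :: p.map D.head) ++ [D.head e] := by simp
      rw [this, List.nodup_append]
      refine ⟨h4, by simp, ?_⟩
      intro a ha b hb hab
      rw [List.mem_singleton] at hb
      subst hab hb
      rcases List.mem_cons.1 ha with ha | ha
      · exact hs ha
      · exact hp ha
    · intro x hx
      rcases List.mem_append.1 hx with hx | hx
      · exact h5 x hx
      · rwa [List.mem_singleton.1 hx]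

theorem IsFlow.exists_isPathIn {D : MultiDigraph V E} {F : Finset E} {s t : V} {k : ℤ}
    (hF : D.IsFlow F s t k) (hk : 0 < k) (hst : t ≠ s) : ∃ p, D.IsPathIn F s t p := by
  classical
  by_contra hp
  have ht : t ∉ D.reach F s := fun h => h.elim hst hp
  have hs : s ∈ D.reach F s := Or.inl rfl
  have hsum := hF ((D.reach F s).indicator 1)
  have hle : ∑ e ∈ F, ((D.reach F s).indicator (1 : V → ℤ) (D.tail e) -
      (D.reach F s).indicator (1 : V → ℤ) (D.head e)) ≤ 0 := by
    refine Finset.sum_nonpos fun e he => ?_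
    by_cases h : D.tail e ∈ D.reach F s
    · simp [h, head_mem_reach (Finset.mem_coe.2 he) h]
    · rw [Set.indicator_of_notMem h]
      have := Set.indicator_nonneg (s := D.reach F s) (f := (1 : V → ℤ)) (by simp) (D.head e)
      omega
  rw [hsum] at hle
  simp [ht, hs] at hle
  omega

theorem IsFlow.hasEdgeDisjointPaths {D : MultiDigraph V E} {s t : V} (hst : t ≠ s) (k : ℕ)
    {F : Finset E} (hF : D.IsFlow F s t k) : D.HasEdgeDisjointPaths F s t k := by
  classical
  induction k generalizing F with
  | zero => exact ⟨Fin.elim0, fun i => i.elim0, fun i => i.elim0⟩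
  | succ k ih =>
    obtain ⟨p, hp⟩ := hF.exists_isPathIn (by positivity) hst
    have hpF : p.toFinset ⊆ F := by
      obtain ⟨-, -, -, -, -, h5⟩ := hp
      exact fun e he => h5 e (List.mem_toFinset.1 he)
    have hF' : D.IsFlow (F \ p.toFinset) s t k := by
      intro g
      rw [Finset.sum_sdiff_eq_sub hpF, hF g, hp.isFlow g]
      push_cast
      ring
    obtain ⟨P, hP, hd⟩ := ih hF'
    have hdp : ∀ i, p.Disjoint (P i) := by
      intro i e hep hei
      obtain ⟨-, -, -, -, -, h5⟩ := hP i
      have := h5 e hei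
      simp [hep] at this
    refine ⟨Fin.cons p P, ?_, ?_⟩
    · refine Fin.cases hp fun i => ?_
      simpa using (hP i).mono (by simp)
    · refine Fin.cases (Fin.cases (by simp) fun j _ => by simpa using hdp j) fun i =>
        Fin.cases (fun _ => by simpa using (hdp i).symm) fun j hij => ?_
      simpa using hd i j (by simpa using hij)

open Classical in
/-- The residual digraph of `D` with respect to `F`: the edges of `F` are reversed. -/
noncomputable def residual (D : MultiDigraph V E) (F : Finset E) : MultiDigraph V E where
  tail e := if e ∈ F then D.head e else D.tail e
  head e := if e ∈ F then D.tail e else D.head e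
  no_loops e := by
    split_ifs
    · exact (D.no_loops e).symm
    · exact D.no_loops e

theorem IsFlow.symmDiff [DecidableEq E] {D : MultiDigraph V E} {F Q : Finset E} {s t : V}
    {k l : ℤ} (hF : D.IsFlow F s t k) (hQ : (D.residual F).IsFlow Q s t l) :
    D.IsFlow (symmDiff F Q) s t (k + l) := by
  intro g
  have hQg := hQ g
  rw [← Finset.sum_inter_add_sum_sdiff Q F] at hQg
  have h₁ : ∑ e ∈ Q ∩ F, (g ((D.residual F).tail e) - g ((D.residual F).head e)) =
      -∑ e ∈ F ∩ Q, (g (D.tail e) - g (D.head e)) := by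
    rw [Finset.inter_comm, ← Finset.sum_neg_distrib]
    refine Finset.sum_congr rfl fun e he => ?_
    simp [residual, (Finset.mem_inter.1 he).1]
  have h₂ : ∑ e ∈ Q \ F, (g ((D.residual F).tail e) - g ((D.residual F).head e)) =
      ∑ e ∈ Q \ F, (g (D.tail e) - g (D.head e)) := by
    refine Finset.sum_congr rfl fun e he => ?_
    simp [residual, (Finset.mem_sdiff.1 he).2]
  have hFg := hF g
  rw [← Finset.sum_inter_add_sum_sdiff F Q] at hFg
  rw [symmDiff_def, Finset.sup_eq_union, Finset.sum_union disjoint_sdiff_sdiff]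
  rw [h₁, h₂] at hQg
  linear_combination hQg + hFg

theorem isFlow_biUnion [DecidableEq E] {D : MultiDigraph V E} {L : Set E} {s t : V} {n : ℕ}
    {P : Fin n → List E} (hP : ∀ i, D.IsPathIn L s t (P i))
    (hd : ∀ i j, i ≠ j → (P i).Disjoint (P j)) :
    D.IsFlow (Finset.univ.biUnion fun i => (P i).toFinset) s t n := by
  intro g
  rw [Finset.sum_biUnion fun i _ j _ hij => List.disjoint_toFinset_iff_disjoint.2 (hd i j hij),
    Finset.sum_congr rfl fun i _ => (hP i).isFlow g]
  simp [mul_sub]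

theorem IsPathIn.exists_leaving {D : MultiDigraph V E} {L : Set E} {s t : V} {p : List E}
    (hp : D.IsPathIn L s t p) {R : Set V} (hs : s ∈ R) (ht : t ∉ R) :
    ∃ e ∈ p, D.tail e ∈ R ∧ D.head e ∉ R := by
  classical
  have h := hp.isFlow (R.indicator 1)
  by_contra! hcon
  have hle : ∑ e ∈ p.toFinset, (R.indicator (1 : V → ℤ) (D.tail e) -
      R.indicator (1 : V → ℤ) (D.head e)) ≤ 0 := by
    refine Finset.sum_nonpos fun e he => ?_
    by_cases h : D.tail e ∈ R
    · simp [h, hcon e (List.mem_toFinset.1 he) h]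
    · rw [Set.indicator_of_notMem h]
      have := Set.indicator_nonneg (s := R) (f := (1 : V → ℤ)) (by simp) (D.head e)
      omega
  rw [h] at hle
  simp [hs, ht] at hle

theorem IsPathIn.leaving_unique {D : MultiDigraph V E} {L : Set E} {s t : V} {p : List E}
    (hp : D.IsPathIn L s t p) {R : Set V} (hs : s ∈ R) (ht : t ∉ R)
    (hR : ∀ e ∈ p, D.head e ∈ R → D.tail e ∈ R) {e f : E} (he : e ∈ p) (hf : f ∈ p)
    (heR : D.tail e ∈ R ∧ D.head e ∉ R) (hfR : D.tail f ∈ R ∧ D.head f ∉ R) : e = f := by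
  classical
  by_contra hef
  have h := hp.isFlow (R.indicator 1)
  have hsub : ({e, f} : Finset E) ⊆ p.toFinset := by
    intro x hx
    rcases Finset.mem_insert.1 hx with rfl | hx
    · simpa using he
    · rw [Finset.mem_singleton.1 hx]
      simpa using hf
  have hle := Finset.sum_le_sum_of_subset_of_nonneg
    (f := fun e => R.indicator (1 : V → ℤ) (D.tail e) - R.indicator (1 : V → ℤ) (D.head e))
    hsub fun x hx _ => by
      by_cases h : D.head x ∈ R
      · simp [h, hR x (List.mem_toFinset.1 hx) h]
      · rw [Set.indicator_of_notMem h, sub_zero]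
        exact Set.indicator_nonneg (by simp) _
  rw [h, Finset.sum_pair hef] at hle
  simp [hs, ht, heR, hfR] at hle

theorem LargeAt.hasEdgeDisjointPaths {D : MultiDigraph V E} {r v : V} {L : Set E} {n : ℕ}
    (h : D.LargeAt r v L) (hn : D.HasEdgeDisjointPaths Set.univ r v n) :
    D.HasEdgeDisjointPaths L r v n := by
  obtain ⟨Ps, C, hPs, hdis, ⟨hC₁, hC₂⟩, hcut⟩ := h
  obtain ⟨P, hP, hd⟩ := hn
  choose c hcP hcC using fun i => hcut (P i) (hP i)
  choose Q hQ hcQ using fun i => hC₂ (c i) (hcC i)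
  refine ⟨Q, fun i => hPs _ (hQ i), fun i j hij => hdis (hQ i) (hQ j) fun heq => ?_⟩
  have hc : c i = c j := (hC₁ (Q i) (hQ i)).unique ⟨hcC i, hcQ i⟩ ⟨hcC j, heq ▸ hcQ j⟩
  exact hd i j hij (hcP i) (hc ▸ hcP j)

/-- A maximum finite family of edge-disjoint paths admits an orthogonal cut. -/
theorem largeAt_of_hasEdgeDisjointPaths {D : MultiDigraph V E} {r v : V} (hv : v ≠ r)
    {L : Set E} {n : ℕ} (hL : D.HasEdgeDisjointPaths L r v n)
    (hnmax : ¬ D.HasEdgeDisjointPaths Set.univ r v (n + 1)) : D.LargeAt r v L := by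
  classical
  obtain ⟨P, hP, hd⟩ := hL
  set F : Finset E := Finset.univ.biUnion fun i => (P i).toFinset with hFdef
  have hF : D.IsFlow F r v n := isFlow_biUnion hP hd
  have hmemF : ∀ e, e ∈ F ↔ ∃ i, e ∈ P i := by simp [hFdef]
  set R := (D.residual F).reach Set.univ r
  have hr : r ∈ R := Or.inl rfl
  have hvR : v ∉ R := by
    rintro (h | ⟨p, hp⟩)
    · exact hv h
    · have hflow : D.IsFlow (symmDiff F p.toFinset) r v ((n + 1 : ℕ) : ℤ) := by
        simpa using hF.symmDiff hp.isFlow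
      obtain ⟨Q, hQ, hQd⟩ := hflow.hasEdgeDisjointPaths hv
      exact hnmax ⟨Q, fun i => (hQ i).mono (Set.subset_univ _), hQd⟩
  have hclosed : ∀ e, (D.residual F).tail e ∈ R → (D.residual F).head e ∈ R :=
    fun e => head_mem_reach (Set.mem_univ e)
  have hout : ∀ e, D.tail e ∈ R → D.head e ∉ R → e ∈ F := by
    intro e ht hh
    by_contra he
    have h := hclosed e
    simp only [residual, if_neg he] at h
    exact hh (h ht)
  have hin : ∀ e ∈ F, D.head e ∈ R → D.tail e ∈ R := by
    intro e he hh
    have h := hclosed e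
    simp only [residual, if_pos he] at h
    exact h hh
  refine ⟨Set.range P, {e | D.tail e ∈ R ∧ D.head e ∉ R}, ?_, ?_, ⟨?_, ?_⟩, ?_⟩
  · rintro _ ⟨i, rfl⟩
    exact hP i
  · rintro _ ⟨i, rfl⟩ _ ⟨j, rfl⟩ hij
    exact hd i j fun h => hij (congrArg P h)
  · rintro _ ⟨i, rfl⟩
    obtain ⟨e, he, heR⟩ := (hP i).exists_leaving hr hvR
    exact ⟨e, ⟨heR, he⟩, fun f hf => (hP i).leaving_unique hr hvR
      (fun x hx => hin x ((hmemF x).2 ⟨i, hx⟩)) hf.2 he hf.1 heR⟩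
  · rintro e ⟨ht, hh⟩
    obtain ⟨i, hi⟩ := (hmemF e).1 (hout e ht hh)
    exact ⟨P i, ⟨i, rfl⟩, hi⟩
  · intro p hp
    exact hp.exists_leaving hr hvR

end MultiDigraph

/-- If the local edge-connectivity `λ_D(r,v)` is finite (it equals
`n`: there are `n` pairwise edge-disjoint `r`–`v` paths in `D` but not `n + 1`), then
`L` is large at `v` if and only if `λ_{D(L)}(r,v) = λ_D(r,v)`, i.e. iff `D(L)` also
admits `n` pairwise edge-disjoint `r`–`v` paths. -/
theorem stmt15 {V E : Type*} (D : MultiDigraph V E) (r : V)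
    (hroot : ∀ e, D.head e ≠ r)
    (v : V) (hv : v ≠ r)
    (L : Set E) (n : ℕ)
    (hn : D.HasEdgeDisjointPaths Set.univ r v n)
    (hnmax : ¬ D.HasEdgeDisjointPaths Set.univ r v (n + 1)) :
    D.LargeAt r v L ↔ D.HasEdgeDisjointPaths L r v n := by
  exact ⟨fun h => h.hasEdgeDisjointPaths hn,
    fun h => MultiDigraph.largeAt_of_hasEdgeDisjointPaths hv h hnmax⟩
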